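/- Let λ be a nonzero real number, let β, α be real numbers with β ≥ 1 and α > 1, and suppose α = 2βm for a positive integer m. Define, for y > 0, F(y) = (1/λ) · y^{1-2β-α}/(1-2β-α) + ∑_{n=-m}^{-1} (λ^{2n+2m+1}/Γ(2n+2m+3)) · y^{2βn+1}/(2βn+1) + ∑_{n=0}^{∞} (λ^{2n+2m+1}/Γ(2n+2m+3)) · y^{2βn+1}/(2βn+1). Then for every x > 0, F is differentiable at x and F′(x) = cosh(λ x^β)/(λ x^{2β+α}). -/

import Mathlib

/-- The `n`-th term of the differentiated series is the `(n + m + 1)`-st term of the power series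
of `cosh (lam * y ^ β)`, divided by `lam * y ^ (2 * β + 2 * β * m)`. -/
theorem coeff_mul_rpow_eq_cosh_term {lam β y : ℝ} (hlam : lam ≠ 0) (hy : 0 < y) {m k : ℕ} {n : ℤ}
    (hk : (k : ℤ) = n + m + 1) :
    lam ^ (2 * n + 2 * (m : ℤ) + 1) / Real.Gamma (2 * (n : ℝ) + 2 * (m : ℝ) + 3) *
        y ^ (2 * β * (n : ℝ)) =
      (lam * y ^ β) ^ (2 * k) / ((2 * k).factorial : ℝ) / (lam * y ^ (2 * β + 2 * β * m)) := by
  have hkR : (k : ℝ) = n + m + 1 := by exact_mod_cast hk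
  have hGamma : Real.Gamma (2 * (n : ℝ) + 2 * (m : ℝ) + 3) = ((2 * k).factorial : ℝ) := by
    rw [← Real.Gamma_nat_eq_factorial]
    congr 1
    push_cast
    linarith
  have hlamPow : lam ^ (2 * n + 2 * (m : ℤ) + 1) * lam = lam ^ (2 * k) := by
    rw [← zpow_add_one₀ hlam, ← zpow_natCast]
    congr 1
    push_cast
    linarith
  have hyPow : y ^ (2 * β * (n : ℝ)) * y ^ (2 * β + 2 * β * m) = (y ^ β) ^ (2 * k) := by
    rw [← Real.rpow_add hy, ← Real.rpow_natCast, ← Real.rpow_mul hy.le]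
    congr 1
    push_cast
    rw [hkR]
    ring
  have hfac : ((2 * k).factorial : ℝ) ≠ 0 := by positivity
  have hy0 : y ^ (2 * β + 2 * β * m) ≠ 0 := by positivity
  rw [hGamma, mul_pow, ← hlamPow, ← hyPow]
  field_simp

theorem coeff_mul_rpow_eq_cosh_term_nat {lam β y : ℝ} (hlam : lam ≠ 0) (hy : 0 < y) (m n : ℕ) :
    lam ^ (2 * n + 2 * m + 1) / Real.Gamma (2 * (n : ℝ) + 2 * (m : ℝ) + 3) *
        y ^ (2 * β * (n : ℝ)) =
      (lam * y ^ β) ^ (2 * (n + (m + 1))) / ((2 * (n + (m + 1))).factorial : ℝ) /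
        (lam * y ^ (2 * β + 2 * β * m)) := by
  have h := coeff_mul_rpow_eq_cosh_term (β := β) (m := m) (k := n + (m + 1)) (n := n) hlam hy
    (by push_cast; ring)
  rw [← h]
  push_cast
  congr 2

theorem summable_coeff_mul_rpow {lam β y : ℝ} (hlam : lam ≠ 0) (hy : 0 < y) (m : ℕ) :
    Summable fun n : ℕ =>
      lam ^ (2 * n + 2 * m + 1) / Real.Gamma (2 * (n : ℝ) + 2 * (m : ℝ) + 3) *
        y ^ (2 * β * (n : ℝ)) := by
  simp_rw [coeff_mul_rpow_eq_cosh_term_nat hlam hy]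
  exact ((summable_nat_add_iff (m + 1)).2 (Real.hasSum_cosh (lam * y ^ β)).summable).div_const _

theorem hasDerivAt_const_mul_rpow_div (c : ℝ) {p x : ℝ} (hx : 0 < x) (hp : p + 1 ≠ 0) :
    HasDerivAt (fun y : ℝ => c * (y ^ (p + 1) / (p + 1))) (c * x ^ p) x := by
  have h := ((Real.hasDerivAt_rpow_const (p := p + 1) (Or.inl hx.ne')).div_const (p + 1)).const_mul c
  rwa [add_sub_cancel_right, mul_div_cancel_left₀ _ hp] at h

theorem hasDerivAt_tsum_coeff_mul_rpow_div {lam β x : ℝ} (hlam : lam ≠ 0) (hβ : 0 ≤ β) (hx : 0 < x)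
    (m : ℕ) :
    HasDerivAt (fun y : ℝ => ∑' n : ℕ,
        (lam ^ (2 * n + 2 * m + 1) / Real.Gamma (2 * (n : ℝ) + 2 * (m : ℝ) + 3)) *
          (y ^ (2 * β * (n : ℝ) + 1) / (2 * β * (n : ℝ) + 1)))
      (∑' n : ℕ, lam ^ (2 * n + 2 * m + 1) / Real.Gamma (2 * (n : ℝ) + 2 * (m : ℝ) + 3) *
        x ^ (2 * β * (n : ℝ))) x := by
  have hexp (n : ℕ) : 0 ≤ 2 * β * (n : ℝ) := by positivity
  have hGamma (n : ℕ) : 0 < Real.Gamma (2 * (n : ℝ) + 2 * (m : ℝ) + 3) :=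
    Real.Gamma_pos_of_pos (by positivity)
  have hxmem : x ∈ Set.Ioo 0 (x + 1) := ⟨hx, lt_add_one x⟩
  refine hasDerivAt_tsum_of_isPreconnected
    (summable_coeff_mul_rpow (β := β) (abs_ne_zero.2 hlam) (by linarith : 0 < x + 1) m)
    isOpen_Ioo isPreconnected_Ioo
    (fun n y hy => hasDerivAt_const_mul_rpow_div _ hy.1 (by linarith [hexp n])) ?_ hxmem ?_ hxmem
  · intro n y hy
    have hle := Real.rpow_le_rpow hy.1.le hy.2.le (hexp n)
    rw [norm_mul, norm_div, norm_pow, Real.norm_eq_abs, Real.norm_eq_abs, Real.norm_eq_abs,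
      abs_of_pos (hGamma n), abs_of_nonneg (Real.rpow_nonneg hy.1.le _)]
    have := hGamma n
    gcongr
  · refine Summable.of_norm_bounded
      ((summable_coeff_mul_rpow (β := β) (abs_ne_zero.2 hlam) hx m).mul_right x) fun n => ?_
    have := hGamma n
    have hdiv : x ^ (2 * β * (n : ℝ) + 1) / (2 * β * (n : ℝ) + 1) ≤ x ^ (2 * β * (n : ℝ)) * x := by
      rw [← Real.rpow_add_one hx.ne']
      exact div_le_self (by positivity) (by linarith [hexp n])
    have hnonneg : 0 ≤ x ^ (2 * β * (n : ℝ) + 1) / (2 * β * (n : ℝ) + 1) := by positivity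
    rw [norm_mul, norm_div, norm_pow, Real.norm_eq_abs, Real.norm_eq_abs, Real.norm_eq_abs,
      abs_of_pos (hGamma n), abs_of_nonneg hnonneg]
    exact (mul_le_mul_of_nonneg_left hdiv (by positivity)).trans_eq (mul_assoc _ _ _).symm

theorem sum_Icc_neg_eq_sum_range {M : Type*} [AddCommMonoid M] (f : ℤ → M) (m : ℕ) :
    ∑ n ∈ Finset.Icc (-(m : ℤ)) (-1), f n = ∑ j ∈ Finset.range m, f ((j : ℤ) - m) := by
  refine Finset.sum_nbij' (fun n => (n + m).toNat) (fun j => (j : ℤ) - m) ?_ ?_ ?_ ?_ ?_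
  · intro n hn
    simp only [Finset.mem_Icc, Finset.mem_range] at *
    omega
  · intro j hj
    simp only [Finset.mem_Icc, Finset.mem_range] at *
    omega
  · intro n hn
    simp only [Finset.mem_Icc] at *
    omega
  · intro j hj
    simp
  · intro n hn
    simp only [Finset.mem_Icc] at hn
    congr 1
    omega

/-- The expansion of `cosh (lam * x ^ β) / (lam * x ^ (2 * β + 2 * β * m))` in powers of `x`. -/
theorem cosh_div_eq_sum_add_tsum {lam β x : ℝ} (hlam : lam ≠ 0) (hx : 0 < x) (m : ℕ) :
    Real.cosh (lam * x ^ β) / (lam * x ^ (2 * β + 2 * β * m)) =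
      1 / lam * x ^ (-(2 * β + 2 * β * m)) +
      (∑ n ∈ Finset.Icc (-(m : ℤ)) (-1 : ℤ),
        lam ^ (2 * n + 2 * (m : ℤ) + 1) / Real.Gamma (2 * (n : ℝ) + 2 * (m : ℝ) + 3) *
          x ^ (2 * β * (n : ℝ))) +
      ∑' n : ℕ, lam ^ (2 * n + 2 * m + 1) / Real.Gamma (2 * (n : ℝ) + 2 * (m : ℝ) + 3) *
        x ^ (2 * β * (n : ℝ)) := by
  have hcosh := (Real.hasSum_cosh (lam * x ^ β)).div_const (lam * x ^ (2 * β + 2 * β * m))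
  rw [← hcosh.tsum_eq, ← hcosh.summable.sum_add_tsum_nat_add (m + 1), Finset.sum_range_succ',
    sum_Icc_neg_eq_sum_range]
  congr 1
  · rw [add_comm]
    congr 1
    · rw [Real.rpow_neg hx.le]
      simp [mul_comm]
    · exact Finset.sum_congr rfl fun j _ =>
        (coeff_mul_rpow_eq_cosh_term hlam hx (by push_cast; ring)).symm
  · exact tsum_congr fun n => (coeff_mul_rpow_eq_cosh_term_nat hlam hx m n).symm

/-- Theorem 4, case ε = 0 (hyperbolic cosine integral with `α = 2βm`). -/
theorem cosh_integral_eps_zero (lam β α : ℝ) (hlam : lam ≠ 0) (hβ : 1 ≤ β) (hα : 1 < α)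
    (m : ℕ) (hm : 0 < m) (hαm : α = 2 * β * m) :
    ∀ x : ℝ, 0 < x →
      HasDerivAt (fun y : ℝ =>
        (1 / lam) * (y ^ (1 - 2 * β - α) / (1 - 2 * β - α)) +
        (∑ n ∈ Finset.Icc (-(m : ℤ)) (-1 : ℤ),
          (lam ^ (2 * n + 2 * (m : ℤ) + 1) / Real.Gamma (2 * (n : ℝ) + 2 * (m : ℝ) + 3)) *
            (y ^ (2 * β * (n : ℝ) + 1) / (2 * β * (n : ℝ) + 1))) +
        ∑' n : ℕ,
          (lam ^ (2 * n + 2 * m + 1) / Real.Gamma (2 * (n : ℝ) + 2 * (m : ℝ) + 3)) *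
            (y ^ (2 * β * (n : ℝ) + 1) / (2 * β * (n : ℝ) + 1)))
        (Real.cosh (lam * x ^ β) / (lam * x ^ (2 * β + α))) x := by
  intro x hx
  subst hαm
  rw [cosh_div_eq_sum_add_tsum hlam hx m]
  refine (HasDerivAt.add ?_ (HasDerivAt.fun_sum fun n hn => ?_)).add
    (hasDerivAt_tsum_coeff_mul_rpow_div hlam (by linarith) hx m)
  · have hexp : 1 - 2 * β - 2 * β * m = -(2 * β + 2 * β * m) + 1 := by ring
    rw [hexp]
    exact hasDerivAt_const_mul_rpow_div _ hx (by linarith)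
  · refine hasDerivAt_const_mul_rpow_div _ hx (ne_of_lt ?_)
    have hn' : (n : ℝ) ≤ -1 := by exact_mod_cast (Finset.mem_Icc.1 hn).2
    nlinarith
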